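/- arXiv:1211.5277 — 2 statements merged into one kernel-verified Lean document; each statement's English description precedes it below -/
import Mathlib

section
/- Let ℓ ∈ ℕ with ℓ ≥ 1. Then for every x ∈ ℝ one has (1/(2π)) ∫_{-1}^{1} ((1+it)/(1−it))^ℓ · 2 · e^{-i t x} dt = k^{(ℓ)}(x); in particular this Fourier integral is real-valued. -/
open MeasureTheory Finset

/-- `sinc x = sin x / x` for `x ≠ 0`, `sinc 0 = 1`. -/
noncomputable def sinc (x : ℝ) : ℝ := if x = 0 then 1 else Real.sin x / x

/-- The polynomial `p_ℓ(w) = Σ_{j=0}^{ℓ-1} (1/2^j) · C(ℓ+j-1, ℓ-1) · w^{ℓ-j-1}/(ℓ-j-1)!`. -/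
noncomputable def pPoly (ℓ : ℕ) (w : ℝ) : ℝ :=
  ∑ j ∈ Finset.range ℓ,
    (1 / 2 ^ j : ℝ) * (Nat.choose (ℓ + j - 1) (ℓ - 1)) * w ^ (ℓ - j - 1) /
      (Nat.factorial (ℓ - j - 1))

/-- `g_ℓ(x) = ∫_ℝ e^{-|u|} p_ℓ(|u|) sinc(x−u) du`. -/
noncomputable def gFun (ℓ : ℕ) (x : ℝ) : ℝ :=
  ∫ u : ℝ, Real.exp (-|u|) * pPoly ℓ |u| * sinc (x - u)

/-- The kernel function `k^{(ℓ)}` for `ℓ ≥ 1`. -/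
noncomputable def kl (ℓ : ℕ) (x : ℝ) : ℝ :=
  (1 / (Real.pi * 2 ^ (ℓ - 1))) *
    ∑ n ∈ Finset.range (2 * ℓ + 1),
      (-1 : ℝ) ^ n * (Nat.choose (2 * ℓ) n) * iteratedDeriv n (gFun ℓ) x

lemma cb_step (n m : ℕ) (x y : ℂ) (h : x + y = 1) :
    ∑ j ∈ range (m+1), ((n+1+j).choose j : ℂ) * y^j * x
      = ∑ j ∈ range (m+1), ((n+j).choose j : ℂ) * y^j - ((n+m+1).choose m : ℂ) * y^(m+1) := by
  obtain rfl : x = 1 - y := by rw [← h]; ring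
  induction m with
  | zero => simp
  | succ m ih =>
    rw [sum_range_succ, ih, sum_range_succ _ (m+1)]
    have e1 : (n+1+(m+1)).choose (m+1) = (n+m+1).choose m + (n+(m+1)).choose (m+1) := by
      rw [show n+1+(m+1) = (n+m+1)+1 by ring, Nat.choose_succ_succ]; rfl
    have e2 : (n+(m+1)+1).choose (m+1) = (n+m+1).choose m + (n+(m+1)).choose (m+1) := by
      rw [show n+(m+1)+1 = (n+m+1)+1 by ring, Nat.choose_succ_succ]; rfl
    rw [e1, e2]
    push_cast
    ring

lemma cb (m n : ℕ) (x y : ℂ) (h : x + y = 1) :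
    ∑ j ∈ range (n+1), ((m+j).choose j : ℂ) * x^j * y^(m+1)
     + ∑ j ∈ range (m+1), ((n+j).choose j : ℂ) * y^j * x^(n+1) = 1 := by
  induction n with
  | zero =>
    have : x = 1 - y := by rw [← h]; ring
    simp only [zero_add, range_one, sum_singleton, pow_zero, add_zero, Nat.choose_zero_right, Nat.choose_self]
    rw [← sum_mul]
    have g := geom_sum_mul y (m+1)
    simp only [Nat.cast_one, one_mul, pow_one]
    rw [this]
    linear_combination -g
  | succ n ih =>
    rw [sum_range_succ]
    have s := cb_step n m x y h
    have : ∑ j ∈ range (m+1), ((n+1+j).choose j : ℂ) * y^j * x^(n+1+1) =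
      (∑ j ∈ range (m+1), ((n+1+j).choose j : ℂ) * y^j * x) * x^(n+1) := by
      rw [sum_mul]; exact sum_congr rfl fun j _ => by ring
    rw [this, s, sub_mul, sum_mul]
    have e : (m+(n+1)).choose (n+1) = (n+m+1).choose m := by
      rw [show n+m+1 = m+(n+1) by ring]
      exact (Nat.choose_symm_add (a := m) (b := n+1)).symm
    rw [e]
    linear_combination ih

lemma cb' (l : ℕ) (hl : 1 ≤ l) (A B : ℂ) (hA : A ≠ 0) (hB : B ≠ 0) (h : A + B = 2) :
    ∑ j ∈ range l, (1 / 2 ^ j : ℂ) * (Nat.choose (l + j - 1) (l - 1)) * (1/A^(l-j-1+1) + 1/B^(l-j-1+1))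
      = 2^l / (A*B)^l := by
  obtain ⟨k, rfl⟩ : ∃ k, l = k+1 := ⟨l-1, by omega⟩
  have c := cb k k (A/2) (B/2) (by rw [← add_div, h]; norm_num)
  rw [← sum_add_distrib] at c
  rw [eq_div_iff (by positivity), sum_mul]
  refine Eq.trans ?_ ((congrArg (fun z => 2^(k+1) * z) c).trans (mul_one _))
  simp only [mul_sum]
  clear c
  refine sum_congr rfl fun j hj => ?_
  have hj : j < k + 1 := by simpa using hj
  obtain ⟨d, rfl⟩ : ∃ d, k = j + d := ⟨k-j, by omega⟩
  have e : (j+d+1+j-1).choose (j+d+1-1) = (j+d+j).choose j := by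
    rw [show j+d+1+j-1 = j+d+j by omega, show j+d+1-1 = j+d by omega]
    exact Nat.choose_symm_add
  rw [e, show j+d+1-j-1+1 = d+1 by omega]
  simp only [div_pow]
  field_simp
  ring

lemma gam (k : ℕ) (c : ℂ) (hc : c.re = 1) :
    IntegrableOn (fun u : ℝ => (u:ℂ)^k * Complex.exp (-(c*u))) (Set.Ioi 0) ∧
    ∫ u in Set.Ioi (0:ℝ), (u:ℂ)^k * Complex.exp (-(c*u)) = k.factorial / c^(k+1) := by
  have hc0 : c ≠ 0 := by rintro rfl; simp at hc
  have hI : ∀ k : ℕ, IntegrableOn (fun u : ℝ => (u:ℂ)^k * Complex.exp (-(c*u))) (Set.Ioi 0) := by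
    intro k
    have h1 := Real.GammaIntegral_convergent (s := k+1) (by positivity)
    refine Integrable.mono' h1 (by fun_prop) ?_
    refine (ae_restrict_iff' measurableSet_Ioi).2 (Filter.Eventually.of_forall fun u hu => ?_)
    have hu : (0:ℝ) < u := hu
    simp [Complex.norm_exp, hc, abs_of_pos hu, mul_comm]
  refine ⟨hI k, ?_⟩
  induction k with
  | zero =>
    have := integral_exp_mul_complex_Ioi (a := -c) (by simp [hc]) 0
    simpa using this
  | succ k ih =>
    have key := integral_Ioi_of_hasDerivAt_of_tendsto (a := (0:ℝ)) (m := (0:ℂ))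
      (f := fun u : ℝ => (u:ℂ)^(k+1) * Complex.exp (-(c*u)))
      (f' := fun u : ℝ => (k+1) * ((u:ℂ)^k * Complex.exp (-(c*u))) - c * ((u:ℂ)^(k+1) * Complex.exp (-(c*u))))
      (by fun_prop) ?_ ?_ ?_
    · rw [integral_sub ((hI k).const_mul _) ((hI (k+1)).const_mul _), integral_const_mul, integral_const_mul, ih] at key
      simp only [Complex.ofReal_zero, zero_pow (Nat.succ_ne_zero k), zero_mul, sub_zero] at key
      rw [eq_div_iff (by positivity)]
      rw [Nat.factorial_succ]
      have key2 : c * ∫ u in Set.Ioi (0:ℝ), (u:ℂ)^(k+1) * Complex.exp (-(c*u)) = (k+1) * (k.factorial / c^(k+1)) := by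
        linear_combination -key
      rw [pow_succ c (k+1), mul_comm (c^(k+1)), ← mul_assoc, mul_comm _ c, key2]
      push_cast; field_simp
    · intro u _
      have h1 : HasDerivAt (fun u : ℝ => (u:ℂ)) 1 u := Complex.ofRealCLM.hasDerivAt
      have h2 := h1.pow (k+1)
      have h3 := ((h1.const_mul c).neg).cexp
      refine (h2.mul h3).congr_deriv ?_
      simp; ring
    · exact ((hI k).const_mul _).sub ((hI (k+1)).const_mul _)
    · rw [tendsto_zero_iff_norm_tendsto_zero]
      refine (Real.tendsto_pow_mul_exp_neg_atTop_nhds_zero (k+1)).congr' ?_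
      filter_upwards [Filter.eventually_gt_atTop 0] with u hu
      simp [Complex.norm_exp, hc, abs_of_pos hu]

lemma sinc_int (y : ℝ) : (sinc y : ℂ) = (1/2) * ∫ t in (-1:ℝ)..1, Complex.exp (-(Complex.I * t * y)) := by
  unfold sinc
  split_ifs with h
  · subst h; simp; norm_num
  · have hy : (y:ℂ) ≠ 0 := by exact_mod_cast h
    have := integral_exp_mul_complex (a := -1) (b := 1) (c := -(Complex.I * y)) (by simp [h])
    rw [show (fun t : ℝ => Complex.exp (-(Complex.I * t * y))) = fun t : ℝ => Complex.exp (-(Complex.I * y) * t) by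
      ext t; congr 1; ring, this]
    push_cast
    rw [Complex.sin]
    have : Complex.I ≠ 0 := Complex.I_ne_zero
    field_simp
    rw [Complex.I_sq]
    ring_nf

/-- Fourier transform of a monomial. -/
lemma mono_int (k : ℕ) (t : ℝ) :
    Integrable (fun u : ℝ => (Real.exp (-|u|) * |u|^k : ℝ) * Complex.exp (Complex.I * t * u)) ∧
    ∫ u : ℝ, (Real.exp (-|u|) * |u|^k : ℝ) * Complex.exp (Complex.I * t * u) =
      k.factorial * (1 / (1 - Complex.I * t)^(k+1) + 1 / (1 + Complex.I * t)^(k+1)) := by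
  obtain ⟨i1, v1⟩ := gam k (1 - Complex.I * t) (by simp)
  obtain ⟨i2, v2⟩ := gam k (1 + Complex.I * t) (by simp)
  set f := fun u : ℝ => ((Real.exp (-|u|) * |u|^k : ℝ) : ℂ) * Complex.exp (Complex.I * t * u) with hf
  have e1 : Set.EqOn (fun u : ℝ => (u:ℂ)^k * Complex.exp (-((1 - Complex.I * t)*u))) f (Set.Ioi 0) := by
    intro u hu
    have hu : (0:ℝ) < u := hu
    simp only [hf, abs_of_pos hu]
    push_cast
    rw [mul_comm (Complex.exp _), mul_assoc, ← Complex.exp_add]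
    ring_nf
  have e2 : Set.EqOn (fun u : ℝ => (u:ℂ)^k * Complex.exp (-((1 + Complex.I * t)*u))) (fun u => f (-u)) (Set.Ioi 0) := by
    intro u hu
    have hu : (0:ℝ) < u := hu
    simp only [hf, abs_neg, abs_of_pos hu]
    push_cast
    rw [mul_comm (Complex.exp _), mul_assoc, ← Complex.exp_add]
    ring_nf
  have j1 : IntegrableOn f (Set.Ioi 0) := i1.congr_fun e1 measurableSet_Ioi
  have j2 : IntegrableOn f (Set.Iic 0) := by
    rw [integrableOn_Iic_iff_integrableOn_Iio]
    have := (i2.congr_fun e2 measurableSet_Ioi)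
    have := IntegrableOn.comp_neg_Iio (c := (0:ℝ)) (f := fun u => f (-u)) (by simpa using this)
    simpa using this
  have w1 := setIntegral_congr_fun (μ := volume) measurableSet_Ioi e1
  have w2 := setIntegral_congr_fun (μ := volume) measurableSet_Ioi e2
  rw [integral_comp_neg_Ioi, neg_zero] at w2
  constructor
  · rw [← integrableOn_univ, ← Set.Iic_union_Ioi (a := (0:ℝ))]
    exact j2.union j1
  · rw [← intervalIntegral.integral_Iic_add_Ioi j2 j1, ← w1, ← w2, v1, v2]
    ring
lemma f_int (l : ℕ) (hl : 1 ≤ l) (t : ℝ) :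
    Integrable (fun u : ℝ => ((Real.exp (-|u|) * pPoly l |u| : ℝ):ℂ) * Complex.exp (Complex.I * t * u)) ∧
    ∫ u : ℝ, ((Real.exp (-|u|) * pPoly l |u| : ℝ):ℂ) * Complex.exp (Complex.I * t * u) =
      2^l / ((1 - Complex.I * t) * (1 + Complex.I * t))^l := by
  have e : (fun u : ℝ => ((Real.exp (-|u|) * pPoly l |u| : ℝ):ℂ) * Complex.exp (Complex.I * t * u)) =
    fun u => ∑ j ∈ range l, ((1 / 2 ^ j : ℂ) * (Nat.choose (l + j - 1) (l - 1)) / (Nat.factorial (l - j - 1))) *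
      ((Real.exp (-|u|) * |u|^(l-j-1) : ℝ) * Complex.exp (Complex.I * t * u)) := by
    ext u
    unfold pPoly
    push_cast
    rw [mul_sum, sum_mul]
    exact sum_congr rfl fun j _ => by ring
  have ne : ∀ s : ℝ, 1 + Complex.I * s ≠ 0 := fun s h => by
    have := congrArg Complex.re h; simp at this
  rw [e]
  constructor
  · exact integrable_finsetSum _ fun j _ => (mono_int _ t).1.const_mul _
  · rw [integral_finsetSum _ fun j _ => (mono_int _ t).1.const_mul _]
    rw [← cb' l hl (1 - Complex.I * t) (1 + Complex.I * t)
      (by have := ne (-t); push_cast at this; rwa [mul_neg, ← sub_eq_add_neg] at this) (ne t) (by ring)]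
    refine sum_congr rfl fun j _ => ?_
    rw [integral_const_mul, (mono_int _ t).2]
    have : ((l-j-1).factorial : ℂ) ≠ 0 := by exact_mod_cast Nat.factorial_ne_zero _
    field_simp

/-- The Fourier multiplier. -/
noncomputable def FF (l : ℕ) (t : ℝ) : ℂ := 2^l / ((1 - Complex.I * t) * (1 + Complex.I * t))^l

lemma ne1 (s : ℝ) : 1 + Complex.I * s ≠ 0 := fun h => by
    have := congrArg Complex.re h; simp at this

lemma ne2 (t : ℝ) : 1 - Complex.I * t ≠ 0 := by
  have := ne1 (-t); push_cast at this; rwa [mul_neg, ← sub_eq_add_neg] at this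

lemma FF_cont (l : ℕ) : Continuous (FF l) := by
  unfold FF
  refine Continuous.div (by fun_prop) (by fun_prop) fun t => ?_
  exact pow_ne_zero _ (mul_ne_zero (ne2 t) (ne1 t))

lemma g_eq (l : ℕ) (hl : 1 ≤ l) (x : ℝ) :
    (gFun l x : ℂ) = (1/2) * ∫ t in (-1:ℝ)..1, FF l t * Complex.exp (-(Complex.I * t * x)) := by
  have hint : Integrable (fun u : ℝ => ((Real.exp (-|u|) * pPoly l |u| : ℝ):ℂ)) := by
    simpa using (f_int l hl 0).1
  have sw := intervalIntegral_integral_swap (a := -1) (b := 1) (μ := volume)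
    (f := fun t u : ℝ => Complex.exp (-(Complex.I * t * (x-u))) * ((Real.exp (-|u|) * pPoly l |u| : ℝ):ℂ)) ?_
  · have l1 : ∀ t : ℝ, ∫ u : ℝ, Complex.exp (-(Complex.I * t * (x-u))) * ((Real.exp (-|u|) * pPoly l |u| : ℝ):ℂ)
      = FF l t * Complex.exp (-(Complex.I * t * x)) := by
      intro t
      unfold FF
      rw [← (f_int l hl t).2, ← integral_mul_const]
      congr 1; ext u
      rw [mul_comm, mul_assoc (_ : ℂ) (Complex.exp _) (Complex.exp _), ← Complex.exp_add]
      ring_nf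
    simp_rw [l1] at sw
    rw [sw, ← integral_const_mul]
    unfold gFun
    rw [← integral_complex_ofReal]
    congr 1; ext u
    rw [intervalIntegral.integral_mul_const]
    have := sinc_int (x-u)
    push_cast at this ⊢
    rw [this]; ring
  · have h0 : Integrable (fun _ : ℝ => (1:ℂ)) (volume.restrict (Set.uIoc (-1:ℝ) 1)) := by
      rw [Set.uIoc_of_le (by norm_num)]
      exact integrable_const _
    have h1 := h0.mul_prod hint
    simp only [one_mul] at h1
    refine h1.bdd_mul (c := 1) (f := fun z : ℝ × ℝ => Complex.exp (-(Complex.I * z.1 * (x-z.2)))) (by fun_prop) ?_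
    refine Filter.Eventually.of_forall fun z => ?_
    simp [Complex.norm_exp]

lemma G_deriv (F : ℝ → ℂ) (hF : Continuous F) (x : ℝ) :
    HasDerivAt (fun x : ℝ => ∫ t in (-1:ℝ)..1, F t * Complex.exp (-(Complex.I * t * x)))
      (∫ t in (-1:ℝ)..1, (-(Complex.I * t) * F t) * Complex.exp (-(Complex.I * t * x))) x := by
  refine (intervalIntegral.hasDerivAt_integral_of_dominated_loc_of_deriv_le (s := Set.univ) (𝕜 := ℝ) (E := ℂ) (μ := volume)
    (F := fun (x : ℝ) t => F t * Complex.exp (-(Complex.I * t * x)))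
    (F' := fun (x : ℝ) t => (-(Complex.I * t) * F t) * Complex.exp (-(Complex.I * t * x)))
    (bound := fun t => ‖(-(Complex.I * t) * F t)‖) Filter.univ_mem ?_ ?_ ?_ ?_ ?_ ?_).2
  · exact Filter.Eventually.of_forall fun y => (by fun_prop)
  · exact Continuous.intervalIntegrable (by fun_prop) _ _
  · fun_prop
  · refine Filter.Eventually.of_forall fun t _ y _ => ?_
    rw [norm_mul]
    simp [Complex.norm_exp]
  · exact Continuous.intervalIntegrable (by fun_prop) _ _
  · refine Filter.Eventually.of_forall fun t _ y _ => ?_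
    have h1 : HasDerivAt (fun u : ℝ => (u:ℂ)) 1 y := Complex.ofRealCLM.hasDerivAt
    refine (((h1.const_mul (Complex.I * t)).neg.cexp).const_mul (F t)).congr_deriv ?_
    simp; ring

lemma real_deriv (h : ℝ → ℝ) (c : ℂ) (x : ℝ) (H : HasDerivAt (fun x => (h x : ℂ)) c x) :
    ((deriv h x : ℝ) : ℂ) = c := by
  have h1 : HasDerivAt h c.re x := by
    have := Complex.reCLM.hasFDerivAt.comp_hasDerivAt x H
    simpa [Function.comp_def] using this
  rw [h1.deriv]
  exact h1.ofReal_comp.unique H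

lemma g_iter (l : ℕ) (hl : 1 ≤ l) (n : ℕ) (x : ℝ) :
    ((iteratedDeriv n (gFun l) x : ℝ) : ℂ) =
      (1/2) * ∫ t in (-1:ℝ)..1, ((-(Complex.I * t))^n * FF l t) * Complex.exp (-(Complex.I * t * x)) := by
  have := FF_cont l
  induction n generalizing x with
  | zero => simpa using g_eq l hl x
  | succ n ih =>
    rw [iteratedDeriv_succ]
    apply real_deriv
    simp_rw [ih]
    refine ((G_deriv (fun t => (-(Complex.I * t))^n * FF l t) (by fun_prop) x).const_mul (1/2)).congr_deriv ?_
    congr 2; ext t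
    rw [pow_succ]; ring

theorem stmt_5 (ℓ : ℕ) (hℓ : 1 ≤ ℓ) (x : ℝ) :
    (1 / (2 * (Real.pi : ℂ))) *
        ∫ t in (-1 : ℝ)..1,
          ((1 + Complex.I * t) / (1 - Complex.I * t)) ^ ℓ * 2 * Complex.exp (-(Complex.I * t * x)) =
      ((kl ℓ x : ℝ) : ℂ) := by
  have hc := FF_cont ℓ
  unfold kl
  push_cast
  simp_rw [g_iter ℓ hℓ, ← mul_assoc]
  simp_rw [← intervalIntegral.integral_const_mul]
  rw [← intervalIntegral.integral_finsetSum
    (fun n _ => Continuous.intervalIntegrable (by fun_prop) _ _),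
    ← intervalIntegral.integral_const_mul]
  congr 1; ext t
  have b := add_pow (Complex.I * t) 1 (2*ℓ)
  have : ∑ n ∈ range (2*ℓ+1), (-1:ℂ)^n * ((2*ℓ).choose n) * (1/2) * (((-(Complex.I * t))^n * FF ℓ t) * Complex.exp (-(Complex.I * t * x)))
    = (1 + Complex.I * t)^(2*ℓ) * (1/2) * FF ℓ t * Complex.exp (-(Complex.I * t * x)) := by
    rw [add_comm 1, b, sum_mul, sum_mul, sum_mul]
    refine sum_congr rfl fun n _ => ?_
    rw [neg_pow (Complex.I * t)]
    have : (-1:ℂ)^n * (-1)^n = 1 := by rw [← mul_pow]; simp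
    simp only [one_pow, mul_one]
    linear_combination ((2*ℓ).choose n) * (1/2) * (((Complex.I * t)^n * FF ℓ t) * Complex.exp (-(Complex.I * t * x))) * this
  simp only [← mul_assoc] at this ⊢
  rw [this]
  obtain ⟨k, rfl⟩ : ∃ k, ℓ = k+1 := ⟨ℓ-1, by omega⟩
  unfold FF
  have h1 := ne1 t
  have h2 := ne2 t
  have hp : (Real.pi:ℂ) ≠ 0 := by exact_mod_cast Real.pi_ne_zero
  simp only [Nat.add_sub_cancel, div_pow, mul_pow]
  field_simp
  ring
end

section
/- Let ℓ ∈ ℕ with ℓ ≥ 1. Then for every x ∈ ℝ one has (1/(π·2^{ℓ-1})) · Σ_{n=0}^{2ℓ} (−1)^n · binomial(2ℓ, n) · ∫_ℝ e^{-|y|} · p_ℓ(|y|) · s_n(x−y) dy = (2/π) · sin(x − ℓπ/2), where s_n denotes the n-th iterated derivative of the sine function (so s_n(w) = sin(w + nπ/2)). -/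
open MeasureTheory Finset

lemma cb1 (k : ℕ) (v : ℂ) (m : ℕ) :
    (1 - v) * ∑ j ∈ range (m + 1), (Nat.choose (k + 1 + j) j : ℂ) * v ^ j
      = ∑ j ∈ range (m + 1), (Nat.choose (k + j) j : ℂ) * v ^ j
        - (Nat.choose (k + 1 + m) m : ℂ) * v ^ (m + 1) := by
  induction m with
  | zero => simp
  | succ m ih =>
    rw [sum_range_succ, mul_add, ih, sum_range_succ _ (m + 1)]
    have h : Nat.choose (k + 1 + (m + 1)) (m + 1)
        = Nat.choose (k + 1 + m) m + Nat.choose (k + (m + 1)) (m + 1) := by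
      rw [show k + 1 + (m + 1) = (k + 1 + m) + 1 by ring, Nat.choose_succ_succ]
      congr 2; ring
    rw [h]; push_cast; ring

lemma cb2 (u v : ℂ) (h : u + v = 1) (n : ℕ) :
    ∑ j ∈ range (n + 1), (Nat.choose (n + j) j : ℂ) * (u ^ (n + 1) * v ^ j + v ^ (n + 1) * u ^ j)
      = 1 := by
  have key : ∀ n : ℕ, ∑ j ∈ range (n + 1),
      (Nat.choose (n + j) j : ℂ) * (u ^ (n + 1) * v ^ j + v ^ (n + 1) * u ^ j)
      = u ^ (n + 1) * ∑ j ∈ range (n + 1), (Nat.choose (n + j) j : ℂ) * v ^ j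
      + v ^ (n + 1) * ∑ j ∈ range (n + 1), (Nat.choose (n + j) j : ℂ) * u ^ j := by
    intro n
    rw [mul_sum, mul_sum, ← sum_add_distrib]
    exact sum_congr rfl fun j _ => by ring
  induction n with
  | zero => simpa using h
  | succ n ih =>
    rw [key] at ih ⊢
    have h1 := cb1 n v (n + 1)
    have h2 := cb1 n u (n + 1)
    rw [show 1 - v = u by rw [← h]; ring] at h1
    rw [show 1 - u = v by rw [← h]; ring] at h2
    rw [pow_succ u (n + 1), pow_succ v (n + 1), mul_assoc, mul_assoc, h1, h2,
      sum_range_succ, sum_range_succ _ (n + 1)]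
    have h3 : (Nat.choose (n + 1 + (n + 1)) (n + 1) : ℂ) = 2 * Nat.choose (n + (n + 1)) (n + 1) := by
      have : Nat.choose (n + 1 + (n + 1)) (n + 1) = 2 * Nat.choose (n + (n + 1)) (n + 1) := by
        rw [show n + 1 + (n + 1) = (n + (n + 1)) + 1 by ring, Nat.choose_succ_succ,
          two_mul, show n + (n + 1) = 2 * n + 1 by ring, Nat.choose_symm_half]
      rw [this]; push_cast; ring
    rw [h3]
    have hv : v = 1 - u := by rw [← h]; ring
    linear_combination ih - 2 * (Nat.choose (n + (n + 1)) (n + 1) : ℂ) * u ^ (n+1) * v ^ (n+1) * h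

lemma itd (n : ℕ) (w : ℝ) : iteratedDeriv n Real.sin w = Real.sin (w + n * Real.pi / 2) := by
  induction n generalizing w with
  | zero => simp
  | succ n ih =>
    rw [iteratedDeriv_succ, funext ih]
    have : HasDerivAt (fun w : ℝ => Real.sin (w + n * Real.pi / 2))
      (Real.cos (w + n * Real.pi / 2) * 1) w :=
      (Real.hasDerivAt_sin _).comp w ((hasDerivAt_id w).add_const _)
    rw [this.deriv, mul_one, ← Real.sin_add_pi_div_two]
    congr 1; push_cast; ring

lemma intg (m : ℕ) : IntegrableOn (fun y : ℝ => Real.exp (-y) * y ^ m) (Set.Ioi 0) := by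
  have := Real.GammaIntegral_convergent (s := m + 1) (by positivity)
  simpa using this

lemma intgc (m : ℕ) : IntegrableOn
    (fun y : ℝ => ((y : ℂ) ^ m / m.factorial) * Complex.exp (-(1 + Complex.I) * y)) (Set.Ioi 0) := by
  refine ((intg m).div_const (m.factorial : ℝ)).mono' (by fun_prop) ?_
  filter_upwards [ae_restrict_mem measurableSet_Ioi] with y hy
  have hy : (0:ℝ) < y := hy
  rw [norm_mul, Complex.norm_exp]
  simp [abs_of_pos hy]
  apply le_of_eq; ring

lemma lap (m : ℕ) : ∫ y in Set.Ioi (0:ℝ),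
    ((y : ℂ) ^ m / m.factorial) * Complex.exp (-(1 + Complex.I) * y) = (1 / (1 + Complex.I)) ^ (m + 1) := by
  have hc : (1 + Complex.I) ≠ 0 := by
    intro h; have := congrArg Complex.re h; simp at this
  have hten : ∀ m : ℕ, Filter.Tendsto (fun y : ℝ => -((y : ℂ) ^ m / m.factorial) * Complex.exp (-(1 + Complex.I) * y) / (1 + Complex.I))
      Filter.atTop (nhds 0) := by
    intro m
    rw [← zero_div (1 + Complex.I)]
    refine Filter.Tendsto.div_const ?_ _
    have := (Real.tendsto_pow_mul_exp_neg_atTop_nhds_zero m).div_const (m.factorial : ℝ)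
    rw [zero_div] at this
    refine squeeze_zero_norm' ?_ this
    filter_upwards [Filter.eventually_gt_atTop 0] with y hy
    rw [norm_mul, Complex.norm_exp]
    simp [abs_of_pos hy]
    apply le_of_eq; ring
  have hexp : ∀ y : ℝ, HasDerivAt (fun y : ℝ => Complex.exp (-(1 + Complex.I) * y))
      (Complex.exp (-(1 + Complex.I) * y) * (-(1 + Complex.I))) y := by
    intro y
    have := ((Complex.ofRealCLM.hasDerivAt (x := y)).const_mul (-(1 + Complex.I))).cexp
    simpa using this
  induction m with
  | zero =>
    have := integral_Ioi_of_hasDerivAt_of_tendsto (a := (0:ℝ)) (m := 0)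
      (f := fun y : ℝ => -((y : ℂ) ^ 0 / Nat.factorial 0) * Complex.exp (-(1 + Complex.I) * y) / (1 + Complex.I))
      (f' := fun y : ℝ => ((y : ℂ) ^ 0 / Nat.factorial 0) * Complex.exp (-(1 + Complex.I) * y))
      (by fun_prop) (fun y _ => by
        have := ((hexp y).const_mul (-1)).div_const (1 + Complex.I)
        convert! this using 1
        · ext; simp
        · field_simp; simp) (intgc 0) (hten 0)
    rw [this]; simp [neg_div]
  | succ m ih =>
    have := integral_Ioi_of_hasDerivAt_of_tendsto (a := (0:ℝ)) (m := 0)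
      (f := fun y : ℝ => -((y : ℂ) ^ (m+1) / Nat.factorial (m+1)) * Complex.exp (-(1 + Complex.I) * y) / (1 + Complex.I))
      (f' := fun y : ℝ => ((y : ℂ) ^ (m+1) / Nat.factorial (m+1)) * Complex.exp (-(1 + Complex.I) * y)
        - (((y : ℂ) ^ m / Nat.factorial m) * Complex.exp (-(1 + Complex.I) * y)) * (1 / (1 + Complex.I)))
      (by fun_prop) (fun y _ => by
        have := (((((Complex.ofRealCLM.hasDerivAt (x := y)).pow (m+1)).div_const (Nat.factorial (m+1) : ℂ)).neg.mul (hexp y))).div_const (1 + Complex.I)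
        convert! this using 1
        have : (m.factorial : ℂ) ≠ 0 := by exact_mod_cast m.factorial_ne_zero
        have : (m : ℂ) + 1 ≠ 0 := by exact_mod_cast m.succ_ne_zero
        simp [Nat.factorial_succ]
        field_simp
        ring) ((intgc (m+1)).sub ((intgc m).mul_const _)) (hten (m+1))
    rw [integral_sub (intgc (m+1)) ((intgc m).mul_const _), integral_mul_const, ih] at this
    simp at this
    rw [sub_eq_zero] at this
    rw [pow_succ _ (m + 1)]
    simpa using this

lemma trig (ℓ : ℕ) (x : ℝ) : ∑ n ∈ range (2 * ℓ + 1), (-1 : ℝ) ^ n * (Nat.choose (2 * ℓ) n : ℝ) *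
    Real.sin (x + n * Real.pi / 2) = 2 ^ ℓ * Real.sin (x - ℓ * Real.pi / 2) := by
  have h1 : ∀ (t : ℝ), Real.sin t = (Complex.exp (t * Complex.I)).im := fun t => by
    rw [Complex.exp_ofReal_mul_I_im]
  have e1 : ∀ n : ℕ, Complex.exp (((x + n * Real.pi / 2 : ℝ) : ℂ) * Complex.I) =
      Complex.exp (x * Complex.I) * Complex.I ^ n := by
    intro n
    have : Complex.I ^ n = Complex.exp (n * (Real.pi / 2 * Complex.I)) := by
      rw [Complex.exp_nat_mul, Complex.exp_pi_div_two_mul_I]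
    rw [this, ← Complex.exp_add]
    congr 1; push_cast; ring
  have e2 : Complex.exp (((x - ℓ * Real.pi / 2 : ℝ) : ℂ) * Complex.I) =
      Complex.exp (x * Complex.I) * (-Complex.I) ^ ℓ := by
    rw [← Complex.exp_neg_pi_div_two_mul_I, ← Complex.exp_nat_mul, ← Complex.exp_add]
    congr 1; push_cast; ring
  have e3 : ∑ n ∈ range (2 * ℓ + 1), (((-1 : ℝ) ^ n * (Nat.choose (2 * ℓ) n : ℝ) : ℝ) : ℂ) *
      Complex.exp (((x + n * Real.pi / 2 : ℝ) : ℂ) * Complex.I)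
      = ((2 ^ ℓ : ℝ) : ℂ) * Complex.exp (((x - ℓ * Real.pi / 2 : ℝ) : ℂ) * Complex.I) := by
    rw [e2]
    have := add_pow (-Complex.I) 1 (2 * ℓ)
    have h2 : (-Complex.I + 1) ^ (2 * ℓ) = 2 ^ ℓ * (-Complex.I) ^ ℓ := by
      rw [pow_mul, ← mul_pow]; congr 1
      linear_combination Complex.I_sq
    rw [h2] at this
    simp only [e1]
    push_cast
    rw [mul_left_comm, this, mul_sum]
    refine sum_congr rfl fun n _ => ?_
    rw [neg_pow Complex.I]; simp; ring
  have := congrArg Complex.im e3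
  rw [Complex.im_sum, Complex.im_ofReal_mul] at this
  simp only [Complex.im_ofReal_mul] at this
  simpa only [h1] using this

lemma kc (n : ℕ) : 2 * ∫ y in Set.Ioi (0:ℝ), Real.exp (-y) * pPoly (n + 1) y * Real.cos y = 1 := by
  set u : ℂ := 1 / (1 + Complex.I) with hu
  have hc : (1 + Complex.I) ≠ 0 := by
    intro h; have := congrArg Complex.re h; simp at this
  have hd : (1 - Complex.I) ≠ 0 := by
    intro h; have := congrArg Complex.re h; simp at this
  set v : ℂ := 1 / (1 - Complex.I) with hv
  have hcd : (1 + Complex.I) * (1 - Complex.I) = 2 := by linear_combination -Complex.I_sq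
  have huv : u * v = 1 / 2 := by
    rw [hu, hv, div_mul_div_comm, hcd]; norm_num
  have hsum : u + v = 1 := by
    rw [hu, hv, div_add_div _ _ hc hd, hcd]; ring
  have hconj : (starRingEnd ℂ) u = v := by simp [hu, hv, sub_eq_add_neg]
  have hint : ∀ j ∈ range (n + 1), Integrable (fun y : ℝ =>
      (((1 / 2 ^ j * Nat.choose (n + j) j : ℝ)) : ℂ) *
        (((y : ℂ) ^ (n - j) / (n - j).factorial) * Complex.exp (-(1 + Complex.I) * y)))
        (volume.restrict (Set.Ioi 0)) := fun j _ => (intgc (n - j)).const_mul _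
  have hI : ∫ y in Set.Ioi (0:ℝ), ∑ j ∈ range (n + 1), (((1 / 2 ^ j * Nat.choose (n + j) j : ℝ)) : ℂ) *
        (((y : ℂ) ^ (n - j) / (n - j).factorial) * Complex.exp (-(1 + Complex.I) * y))
      = ∑ j ∈ range (n + 1), (((1 / 2 ^ j * Nat.choose (n + j) j : ℝ)) : ℂ) * u ^ (n - j + 1) := by
    rw [integral_finsetSum _ hint]
    refine sum_congr rfl fun j _ => ?_
    rw [integral_const_mul, lap]
  have hre : ∫ y in Set.Ioi (0:ℝ), Real.exp (-y) * pPoly (n + 1) y * Real.cos y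
      = (∫ y in Set.Ioi (0:ℝ), ∑ j ∈ range (n + 1), (((1 / 2 ^ j * Nat.choose (n + j) j : ℝ)) : ℂ) *
        (((y : ℂ) ^ (n - j) / (n - j).factorial) * Complex.exp (-(1 + Complex.I) * y))).re := by
    rw [← Complex.reCLM_apply, ← Complex.reCLM.integral_comp_comm (integrable_finsetSum _ hint)]
    refine integral_congr_ae (Filter.Eventually.of_forall fun y => ?_)
    simp only [Complex.reCLM_apply, Complex.re_sum, pPoly, mul_sum, sum_mul]
    refine sum_congr rfl fun j _ => ?_
    have h1 : ((y : ℂ) ^ (n - j) / (n - j).factorial) = ((y ^ (n - j) / (n - j).factorial : ℝ) : ℂ) := by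
      push_cast; rfl
    rw [h1, Complex.re_ofReal_mul, Complex.re_ofReal_mul, Complex.exp_re]
    have h2 : Nat.choose (n + 1 + j - 1) (n + 1 - 1) = Nat.choose (n + j) j := by
      rw [show n + 1 + j - 1 = n + j by omega, Nat.add_sub_cancel, Nat.choose_symm_add]
    rw [h2, show n + 1 - j - 1 = n - j by omega]
    simp
    ring
  rw [hre, hI]
  set T := ∑ j ∈ range (n + 1), (((1 / 2 ^ j * Nat.choose (n + j) j : ℝ)) : ℂ) * u ^ (n - j + 1) with hT
  have hTc : T + (starRingEnd ℂ) T = 1 := by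
    rw [← cb2 u v hsum n, hT, map_sum, ← sum_add_distrib]
    refine sum_congr rfl fun j hj => ?_
    rw [map_mul, map_pow, hconj, Complex.conj_ofReal]
    have hj' : j ≤ n := by have := mem_range.1 hj; omega
    obtain ⟨k, rfl⟩ := Nat.exists_eq_add_of_le hj'
    rw [Nat.add_sub_cancel_left]
    push_cast
    rw [← one_div_pow, ← huv]
    ring
  have := congrArg Complex.re hTc
  simp at this
  linarith

lemma intG (ℓ : ℕ) : Integrable (fun y : ℝ => Real.exp (-|y|) * pPoly ℓ |y|) := by
  have h0 : IntegrableOn (fun y : ℝ => Real.exp (-y) * pPoly ℓ y) (Set.Ioi 0) := by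
    simp only [pPoly, mul_sum]
    refine integrable_finsetSum _ fun j _ => ?_
    refine ((intg (ℓ - j - 1)).const_mul
      ((1 / 2 ^ j : ℝ) * (Nat.choose (ℓ + j - 1) (ℓ - 1)) / (Nat.factorial (ℓ - j - 1)))).congr
      (Filter.Eventually.of_forall fun y => ?_)
    simp only; ring
  have h1 : IntegrableOn (fun y : ℝ => Real.exp (-|y|) * pPoly ℓ |y|) (Set.Ioi 0) :=
    h0.congr_fun (fun y hy => by simp only [abs_of_pos (Set.mem_Ioi.1 hy)]) measurableSet_Ioi
  have h2 : IntegrableOn (fun y : ℝ => Real.exp (-|y|) * pPoly ℓ |y|) (Set.Iic 0) := by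
    have := IntegrableOn.comp_neg_Iic (c := (0:ℝ)) (μ := volume)
      (f := fun y : ℝ => Real.exp (-|y|) * pPoly ℓ |y|)
      (by rw [neg_zero, integrableOn_Ici_iff_integrableOn_Ioi]; exact h1)
    simpa only [abs_neg] using this
  rw [← integrableOn_univ, ← Set.Iic_union_Ioi (a := (0:ℝ))]
  exact h2.union h1

lemma conv (n : ℕ) (a : ℝ) :
    ∫ y : ℝ, Real.exp (-|y|) * pPoly (n + 1) |y| * Real.sin (a - y) = Real.sin a := by
  have i1 : ∀ g : ℝ → ℝ, Continuous g → (∀ y, |g y| ≤ 1) →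
      Integrable (fun y : ℝ => Real.exp (-|y|) * pPoly (n + 1) |y| * g y) := fun g hg hb =>
    (intG (n + 1)).mul_bdd (c := 1) hg.aestronglyMeasurable (Filter.Eventually.of_forall hb)
  have h1 := integral_neg_eq_self
    (fun y : ℝ => Real.exp (-|y|) * pPoly (n + 1) |y| * Real.sin (a - y)) volume
  have h2 := integral_add
    (i1 (fun y => Real.sin (a - y)) (by fun_prop) (fun y => Real.abs_sin_le_one _))
    (i1 (fun y => Real.sin (a + y)) (by fun_prop) (fun y => Real.abs_sin_le_one _))
  simp only [abs_neg, sub_neg_eq_add] at h1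
  rw [h1] at h2
  have h3 : (fun y : ℝ => Real.exp (-|y|) * pPoly (n + 1) |y| * Real.sin (a - y)
      + Real.exp (-|y|) * pPoly (n + 1) |y| * Real.sin (a + y))
      = fun y => (2 * Real.sin a) * (Real.exp (-|y|) * pPoly (n + 1) |y| * Real.cos |y|) := by
    funext y
    rw [Real.cos_abs, Real.sin_sub, Real.sin_add]; ring
  rw [h3, integral_const_mul,
    integral_comp_abs (f := fun y => Real.exp (-y) * pPoly (n + 1) y * Real.cos y), kc] at h2
  linarith

theorem stmt_16 (ℓ : ℕ) (hℓ : 1 ≤ ℓ) (x : ℝ) :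
    (1 / (Real.pi * 2 ^ (ℓ - 1))) *
        ∑ n ∈ Finset.range (2 * ℓ + 1),
          (-1 : ℝ) ^ n * (Nat.choose (2 * ℓ) n : ℝ) *
            ∫ y : ℝ, Real.exp (-|y|) * pPoly ℓ |y| * iteratedDeriv n Real.sin (x - y) =
      (2 / Real.pi) * Real.sin (x - ℓ * Real.pi / 2) := by
  obtain ⟨m, rfl⟩ := Nat.exists_eq_add_of_le' hℓ
  have h : ∀ n : ℕ, ∫ y : ℝ, Real.exp (-|y|) * pPoly (m + 1) |y| * iteratedDeriv n Real.sin (x - y)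
      = Real.sin (x + n * Real.pi / 2) := by
    intro n
    rw [← conv m]
    simp only [itd]
    congr 1; funext y; congr 2; ring
  simp only [h]
  rw [trig, Nat.add_sub_cancel, pow_succ]
  have := Real.pi_ne_zero
  field_simp
end
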